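/- arXiv:2110.10090 — 2 statements merged into one kernel-verified Lean document; each statement's English description precedes it below -/
import Mathlib

section
/- Let W = {W ∈ ℝ^{d₁×d₂} : ‖W^⊤‖_{2,1} ≤ B_W} (i.e., the sum of the ℓ² norms of the rows of W is at most B_W), and consider the vector-valued linear function class F = {x ↦ Wx : W ∈ W}. There is an absolute constant c > 0 such that for every ε > 0 and all x^(1), …, x^(N) ∈ ℝ^{d₂} with ‖x^(i)‖₂ ≤ B_X for all i ∈ [N]: log N_∞(F; ε; x^(1), …, x^(N); ‖·‖₂) ≤ c·(B_X B_W)²/ε² · log((2 + B_X B_W/ε)·d₁·N). -/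
open Matrix
open scoped BigOperators

noncomputable section

/-- Euclidean (ℓ²) norm of a vector. -/
def norm2 {d : ℕ} (v : Fin d → ℝ) : ℝ := Real.sqrt (∑ i, (v i) ^ 2)

/-- `‖M‖_{2,1}`: sum of the ℓ² norms of the columns of `M`. -/
def colSum2 {a b : ℕ} (M : Matrix (Fin a) (Fin b) ℝ) : ℝ :=
  ∑ j, norm2 (fun i => M i j)

/-- ∞-norm covering number (smallest cardinality of a proper cover of `F` on the sample
`z`); `⊤` if no finite cover exists. -/
noncomputable def covNum {ι Z E : Type*} [Sub E] (nrm : E → ℝ) (F : Set (Z → E)) (ε : ℝ)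
    (z : ι → Z) : ℕ∞ :=
  sInf {n : ℕ∞ | ∃ C : Finset (Z → E), ↑C ⊆ F ∧ (C.card : ℕ∞) = n ∧
    ∀ f ∈ F, ∃ g ∈ C, ∀ i, nrm (f (z i) - g (z i)) ≤ ε}

/-- The class of linear maps `x ↦ W x` with `‖Wᵀ‖_{2,1} ≤ B_W` (the sum of the ℓ² norms
of the rows of `W` is at most `B_W`). -/
def Flin (d1 d2 : ℕ) (BW : ℝ) : Set ((Fin d2 → ℝ) → (Fin d1 → ℝ)) :=
  {f | ∃ W : Matrix (Fin d1) (Fin d2) ℝ, colSum2 Wᵀ ≤ BW ∧ f = fun x => W *ᵥ x}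

open scoped RealInnerProductSpace in
/-- A vector is approximated, on the sample `x`, by an integer combination of the sample points
with few terms: a minimizer of the `ℓ¹`-penalized squared residual works. -/
theorem exists_int_combination_approx {E ι : Type*} [NormedAddCommGroup E]
    [InnerProductSpace ℝ E] [Fintype ι] (w : E) (x : ι → E) {η B : ℝ} (hη : 0 < η) (hB : 0 < B)
    (hx : ∀ i, ‖x i‖ ≤ B) :
    ∃ c : ι → ℤ, (η * B) ^ 2 * ∑ i, |(c i : ℝ)| ≤ ‖w‖ ^ 2 ∧
      ∀ i, |⟪w - η • ∑ k, (c k : ℝ) • x k, x i⟫| ≤ η * B ^ 2 := by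
  classical
  set r : (ι → ℤ) → E := fun c => w - η • ∑ k, (c k : ℝ) • x k with hr
  set φ : (ι → ℤ) → ℝ := fun c => ‖r c‖ ^ 2 + (η * B) ^ 2 * ∑ i, |(c i : ℝ)| with hφ
  have hp : 0 < (η * B) ^ 2 := by positivity
  have hφ0 : φ 0 = ‖w‖ ^ 2 := by simp [hφ, hr]
  have hfin : {c | φ c ≤ φ 0}.Finite := by
    obtain ⟨M, hM⟩ := exists_nat_ge (‖w‖ ^ 2 / (η * B) ^ 2)
    refine (Set.finite_Icc (fun _ : ι => -(M : ℤ)) (fun _ => (M : ℤ))).subset fun c hc => ?_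
    have hc' : ∑ i, |(c i : ℝ)| ≤ M := by
      refine le_trans ?_ hM
      rw [le_div_iff₀ hp]
      have : φ c ≤ ‖w‖ ^ 2 := hφ0 ▸ hc
      simp only [hφ] at this
      nlinarith [sq_nonneg ‖r c‖]
    have hi : ∀ i, |c i| ≤ (M : ℤ) := fun i => by
      have := (Finset.single_le_sum (f := fun i => |(c i : ℝ)|)
        (fun i _ => abs_nonneg _) (Finset.mem_univ i)).trans hc'
      exact_mod_cast this
    exact ⟨fun i => (abs_le.1 (hi i)).1, fun i => (abs_le.1 (hi i)).2⟩
  obtain ⟨c, hc, hmin⟩ := Set.exists_min_image _ φ hfin ⟨0, le_refl (φ 0)⟩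
  have hmin' : ∀ c', φ c ≤ φ c' := fun c' => by
    by_cases h : φ c' ≤ φ 0
    · exact hmin c' h
    · exact le_trans hc (not_le.1 h).le
  have hstep : ∀ i (s : ℤ), |s| = 1 → (s : ℝ) * ⟪r c, x i⟫ ≤ η * B ^ 2 := fun i s hs => by
    have hs' : |(s : ℝ)| = 1 := by exact_mod_cast hs
    have hs2 : (s : ℝ) ^ 2 = 1 := by rw [← sq_abs, hs', one_pow]
    have hr' : r (c + Pi.single i s) = r c - (η * s) • x i := by
      have : ∑ k, ((Pi.single i s : ι → ℤ) k : ℝ) • x k = (s : ℝ) • x i := by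
        rw [Finset.sum_eq_single i] <;> simp +contextual
      simp only [hr, Pi.add_apply, Int.cast_add, add_smul, Finset.sum_add_distrib, this, smul_add,
        smul_smul]
      abel
    have hl1 : ∑ k, |((c + Pi.single i s : ι → ℤ) k : ℝ)| ≤ ∑ k, |(c k : ℝ)| + 1 := by
      have : ∑ k, |((Pi.single i s : ι → ℤ) k : ℝ)| = 1 := by
        rw [Finset.sum_eq_single i] <;> simp +contextual [hs']
      rw [← this, ← Finset.sum_add_distrib]
      exact Finset.sum_le_sum fun k _ => by
        rw [Pi.add_apply, Int.cast_add]
        exact abs_add_le _ _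
    have h := hmin' (c + Pi.single i s)
    simp only [hφ] at h
    have hn : ‖r c - (η * s) • x i‖ ^ 2
        = ‖r c‖ ^ 2 - 2 * (η * s * ⟪r c, x i⟫) + η ^ 2 * ‖x i‖ ^ 2 := by
      rw [norm_sub_sq_real, inner_smul_right, norm_smul, mul_pow, Real.norm_eq_abs, sq_abs,
        mul_pow, hs2, mul_one]
    rw [hr', hn] at h
    have h1 := mul_le_mul_of_nonneg_left hl1 hp.le
    have h2 : η ^ 2 * ‖x i‖ ^ 2 ≤ η ^ 2 * B ^ 2 := by
      have := hx i
      gcongr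
    have h3 : η * (s * ⟪r c, x i⟫) ≤ η * (η * B ^ 2) := by nlinarith
    exact le_of_mul_le_mul_left h3 hη
  refine ⟨c, ?_, fun i => abs_le.2 ⟨?_, ?_⟩⟩
  · have : φ c ≤ ‖w‖ ^ 2 := hφ0 ▸ hc
    simp only [hφ] at this
    nlinarith [sq_nonneg ‖r c‖]
  · have := hstep i (-1) (by simp)
    push_cast at this
    linarith
  · have := hstep i 1 (by simp)
    push_cast at this
    linarith

open scoped RealInnerProductSpace in
/-- Version of `exists_int_combination_approx` whose step size depends only on `⌊‖w‖ / τ⌋₊`. -/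
theorem exists_int_combination_approx_floor {E ι : Type*} [NormedAddCommGroup E]
    [InnerProductSpace ℝ E] [Fintype ι] (w : E) (x : ι → E) {τ B : ℝ} (hτ : 0 < τ) (hB : 0 < B)
    (hx : ∀ i, ‖x i‖ ≤ B) :
    ∃ c : ι → ℤ, τ * ∑ i, |(c i : ℝ)| ≤ 2 * ‖w‖ ∧
      ∀ i, ⟪w - (√(⌊‖w‖ / τ⌋₊ : ℝ) * τ / B) • ∑ k, (c k : ℝ) • x k, x i⟫ ^ 2
        ≤ τ * B ^ 2 * ‖w‖ := by
  set n := ⌊‖w‖ / τ⌋₊ with hn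
  have hn1 : n * τ ≤ ‖w‖ := by
    rw [← le_div_iff₀ hτ]
    exact Nat.floor_le (by positivity)
  have hn2 : ‖w‖ < (n + 1) * τ := by
    rw [← div_lt_iff₀ hτ]
    exact Nat.lt_floor_add_one _
  rcases Nat.eq_zero_or_pos n with h0 | hpos
  · refine ⟨0, by simp, fun i => ?_⟩
    simp only [h0, Nat.cast_zero, zero_add, one_mul] at hn2
    simp only [h0, Nat.cast_zero, Real.sqrt_zero, zero_mul, zero_div, zero_smul, sub_zero]
    calc ⟪w, x i⟫ ^ 2 ≤ (‖w‖ * B) ^ 2 := by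
          refine sq_le_sq' ?_ ?_
          · have := (abs_le.1 (abs_real_inner_le_norm w (x i))).1
            have := mul_le_mul_of_nonneg_left (hx i) (norm_nonneg w)
            linarith
          · exact (real_inner_le_norm w (x i)).trans
              (mul_le_mul_of_nonneg_left (hx i) (norm_nonneg w))
      _ = ‖w‖ * B ^ 2 * ‖w‖ := by ring
      _ ≤ τ * B ^ 2 * ‖w‖ := by gcongr
  · have hn' : (1 : ℝ) ≤ n := by exact_mod_cast hpos
    have hs : √(n : ℝ) ^ 2 = n := Real.sq_sqrt (by positivity)
    have hspos : 0 < √(n : ℝ) := Real.sqrt_pos.2 (by positivity)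
    obtain ⟨c, hc, happ⟩ := exists_int_combination_approx w x
      (η := √(n : ℝ) * τ / B) (by positivity) hB hx
    refine ⟨c, ?_, fun i => ?_⟩
    · rw [div_mul_cancel₀ _ hB.ne', mul_pow, hs] at hc
      have h2 : ‖w‖ ≤ 2 * (n * τ) := by nlinarith
      have h3 : (n * τ) * (τ * ∑ i, |(c i : ℝ)|) ≤ (n * τ) * (2 * ‖w‖) := by
        nlinarith [norm_nonneg w]
      exact le_of_mul_le_mul_left h3 (by positivity)
    · rw [← sq_abs]
      calc _ ≤ (√(n : ℝ) * τ / B * B ^ 2) ^ 2 := by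
            gcongr
            exact happ i
        _ = √(n : ℝ) ^ 2 * τ ^ 2 * B ^ 2 := by field_simp
        _ = τ * B ^ 2 * (n * τ) := by rw [hs]; ring
        _ ≤ _ := by gcongr

/-- Number of integer vectors of `ℓ¹` norm at most `K`. -/
theorem exists_finset_card_le_of_sum_natAbs_le (α : Type*) [Fintype α] (K : ℕ) :
    ∃ T : Finset (α → ℤ), T.card ≤ (2 * Fintype.card α + 1) ^ K ∧
      ∀ g : α → ℤ, ∑ a, (g a).natAbs ≤ K → g ∈ T := by
  classical
  induction K with
  | zero =>
    refine ⟨{0}, by simp, fun g hg => ?_⟩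
    simp only [nonpos_iff_eq_zero, Finset.sum_eq_zero_iff, Finset.mem_univ, true_imp_iff,
      Int.natAbs_eq_zero] at hg
    exact Finset.mem_singleton.2 (funext hg)
  | succ K ih =>
    obtain ⟨T, hT, hmem⟩ := ih
    refine ⟨(T ×ˢ (Finset.univ : Finset (Option (α × Bool)))).image fun p =>
      p.2.elim p.1 fun q => p.1 + Pi.single q.1 (if q.2 then 1 else -1), ?_, fun g hg => ?_⟩
    · refine Finset.card_image_le.trans ?_
      rw [Finset.card_product, Finset.card_univ, Fintype.card_option, Fintype.card_prod,
        Fintype.card_bool, pow_succ, mul_comm (Fintype.card α)]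
      gcongr
    · simp only [Finset.mem_image, Finset.mem_product, Finset.mem_univ, and_true, Prod.exists]
      by_cases h0 : ∀ a, g a = 0
      · exact ⟨g, none, hmem g (by simp [h0]), rfl⟩
      · push Not at h0
        obtain ⟨a, ha⟩ := h0
        set s : ℤ := if 0 < g a then 1 else -1 with hs
        refine ⟨g - Pi.single a s, some (a, decide (0 < g a)), hmem _ ?_, ?_⟩
        · have h1 : ∑ b ∈ Finset.univ.erase a, ((g - Pi.single a s : α → ℤ) b).natAbs
              = ∑ b ∈ Finset.univ.erase a, (g b).natAbs :=
            Finset.sum_congr rfl fun b hb => by simp [Finset.ne_of_mem_erase hb]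
          rw [← Finset.add_sum_erase _ _ (Finset.mem_univ a)] at hg ⊢
          rw [h1]
          have h2 : ((g - Pi.single a s : α → ℤ) a).natAbs + 1 = (g a).natAbs := by
            simp only [Pi.sub_apply, Pi.single_eq_same, hs]
            split_ifs <;> omega
          omega
        · simp [hs]

/-- A code of the class such that functions with equal codes are `ε`-close on the sample bounds
the covering number. -/
theorem covNum_le_card_of_code {ι Z E T : Type*} [Sub E] [Nonempty E] {nrm : E → ℝ} {F : Set (Z → E)} {ε : ℝ}
    {z : ι → Z} (S : Finset T) (enc : (Z → E) → T) (hS : ∀ f ∈ F, enc f ∈ S)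
    (hclose : ∀ f ∈ F, ∀ g ∈ F, enc f = enc g → ∀ i, nrm (f (z i) - g (z i)) ≤ ε) :
    covNum nrm F ε z ≤ S.card := by
  classical
  choose! rep hrep using fun (t : T) (h : t ∈ enc '' F) => h
  have hle : covNum nrm F ε z ≤ (({t ∈ S | t ∈ enc '' F}.image rep).card : ℕ∞) := by
    refine sInf_le ⟨_, fun g hg => ?_, rfl, fun f hf => ⟨rep (enc f), ?_, ?_⟩⟩
    · obtain ⟨t, ht, rfl⟩ := Finset.mem_image.1 hg
      exact (hrep t (Finset.mem_filter.1 ht).2).1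
    · exact Finset.mem_image_of_mem _ (Finset.mem_filter.2 ⟨hS f hf, f, hf, rfl⟩)
    · have h := hrep (enc f) ⟨f, hf, rfl⟩
      exact hclose f hf _ h.1 h.2.symm
  exact hle.trans (by exact_mod_cast Finset.card_image_le.trans (Finset.card_filter_le _ _))

theorem norm2_eq_norm {d : ℕ} (v : Fin d → ℝ) : norm2 v = ‖WithLp.toLp 2 v‖ := by
  simp [norm2, EuclideanSpace.norm_eq]

theorem norm2_le_of_sum_sq_le {d : ℕ} {v : Fin d → ℝ} {ε : ℝ} (hε : 0 ≤ ε)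
    (h : ∑ i, v i ^ 2 ≤ ε ^ 2) : norm2 v ≤ ε :=
  Real.sqrt_le_iff.2 ⟨hε, h⟩

open scoped RealInnerProductSpace in
theorem covNum_Flin_le_pow {d1 d2 N : ℕ} {BW B ε τ : ℝ} (hτ : 0 < τ) (hB : 0 < B) (hε : 0 ≤ ε)
    (h : 4 * τ * B ^ 2 * BW ≤ ε ^ 2) (x : Fin N → Fin d2 → ℝ) (hx : ∀ i, norm2 (x i) ≤ B) :
    covNum norm2 (Flin d1 d2 BW) ε x
      ≤ (((2 * (d1 * (N + 1)) + 1) ^ ⌊3 * BW / τ⌋₊ : ℕ) : ℕ∞) := by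
  obtain ⟨S, hcard, hS⟩ :=
    exists_finset_card_le_of_sum_natAbs_le (Fin d1 × Option (Fin N)) ⌊3 * BW / τ⌋₊
  simp only [Fintype.card_prod, Fintype.card_option, Fintype.card_fin] at hcard
  choose! W hW hWf using fun f (hf : f ∈ Flin d1 d2 BW) => hf
  let w : ((Fin d2 → ℝ) → Fin d1 → ℝ) → Fin d1 → EuclideanSpace ℝ (Fin d2) :=
    fun f j => WithLp.toLp 2 (W f j)
  have hw : ∀ f ∈ Flin d1 d2 BW, ∑ j, ‖w f j‖ ≤ BW := fun f hf => by
    have h := hW f hf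
    simp only [colSum2, norm2_eq_norm] at h
    exact h
  have hfw : ∀ f ∈ Flin d1 d2 BW, ∀ i j, f (x i) j = ⟪w f j, WithLp.toLp 2 (x i)⟫ :=
    fun f hf i j => by
      rw [EuclideanSpace.inner_toLp_toLp, star_trivial, dotProduct_comm]
      exact congrFun (congrFun (hWf f hf) (x i)) j
  choose c hc happ using fun f j => exists_int_combination_approx_floor (w f j)
    (fun i => WithLp.toLp 2 (x i)) hτ hB fun i => (norm2_eq_norm (x i)).symm.trans_le (hx i)
  refine (covNum_le_card_of_code S
    (fun f p => p.2.elim (⌊‖w f p.1‖ / τ⌋₊ : ℤ) (c f p.1)) (fun f hf => hS _ ?_)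
    fun f hf g hg hfg i => norm2_le_of_sum_sq_le hε ?_).trans (by exact_mod_cast hcard)
  · refine Nat.le_floor ?_
    have hrow : ∀ j, (⌊‖w f j‖ / τ⌋₊ : ℝ) + ∑ i, |(c f j i : ℝ)| ≤ 3 / τ * ‖w f j‖ := fun j => by
      have h1 : (⌊‖w f j‖ / τ⌋₊ : ℝ) ≤ ‖w f j‖ / τ := Nat.floor_le (by positivity)
      have h2 : ∑ i, |(c f j i : ℝ)| ≤ 2 * ‖w f j‖ / τ := by
        rw [le_div_iff₀ hτ, mul_comm]
        exact hc f j
      calc _ ≤ _ := add_le_add h1 h2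
        _ = _ := by ring
    simp only [Fintype.sum_prod_type, Fintype.sum_option, Option.elim_none, Option.elim_some,
      Int.natAbs_natCast, Nat.cast_sum, Nat.cast_add, Nat.cast_natAbs, Int.cast_abs]
    calc _ ≤ ∑ j, 3 / τ * ‖w f j‖ := Finset.sum_le_sum fun j _ => hrow j
      _ = 3 / τ * ∑ j, ‖w f j‖ := by rw [Finset.mul_sum]
      _ ≤ 3 / τ * BW := by have := hw f hf; gcongr
      _ = 3 * BW / τ := by ring
  · have hn : ∀ j, ⌊‖w f j‖ / τ⌋₊ = ⌊‖w g j‖ / τ⌋₊ := fun j => by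
      simpa using congrFun hfg (j, none)
    have hcc : ∀ j, c f j = c g j := fun j => funext fun k => by
      simpa using congrFun hfg (j, some k)
    have hrow : ∀ j, (f (x i) - g (x i)) j ^ 2
        ≤ 2 * (τ * B ^ 2) * (‖w f j‖ + ‖w g j‖) := fun j => by
      have h1 := happ f j i
      have h2 := happ g j i
      rw [hn, hcc, inner_sub_left] at h1
      rw [inner_sub_left] at h2
      rw [Pi.sub_apply, hfw f hf, hfw g hg]
      set y := ⟪(√(⌊‖w g j‖ / τ⌋₊ : ℝ) * τ / B) •
        ∑ k, (c g j k : ℝ) • (WithLp.toLp 2 (x k) : EuclideanSpace ℝ (Fin d2)),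
        WithLp.toLp 2 (x i)⟫
      nlinarith [sq_nonneg ((⟪w f j, WithLp.toLp 2 (x i)⟫ - y)
        + (⟪w g j, WithLp.toLp 2 (x i)⟫ - y))]
    calc _ ≤ ∑ j, 2 * (τ * B ^ 2) * (‖w f j‖ + ‖w g j‖) := Finset.sum_le_sum fun j _ => hrow j
      _ = 2 * (τ * B ^ 2) * (∑ j, ‖w f j‖ + ∑ j, ‖w g j‖) := by
        rw [← Finset.mul_sum, Finset.sum_add_distrib]
      _ ≤ 2 * (τ * B ^ 2) * (BW + BW) := by have := hw f hf; have := hw g hg; gcongr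
      _ = 4 * τ * B ^ 2 * BW := by ring
      _ ≤ ε ^ 2 := h

theorem covNum_Flin_le_one_of_subsingleton {d1 d2 N : ℕ} {BW ε : ℝ} (hε : 0 ≤ ε)
    (h : d1 = 0 ∨ N = 0) (x : Fin N → Fin d2 → ℝ) :
    covNum norm2 (Flin d1 d2 BW) ε x ≤ 1 := by
  refine (covNum_le_card_of_code {()} (fun _ => ()) (fun _ _ => Finset.mem_singleton_self _)
    fun f _ g _ _ i => ?_).trans (by simp)
  rcases h with rfl | rfl
  · simpa [norm2] using hε
  · exact i.elim0

theorem covNum_Flin_le_one_of_mul_eq_zero {d1 d2 N : ℕ} {BW BX ε : ℝ} (hBW : 0 ≤ BW)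
    (hBX : 0 ≤ BX) (hε : 0 < ε) (h : BX * BW = 0) (x : Fin N → Fin d2 → ℝ)
    (hx : ∀ i, norm2 (x i) ≤ BX) :
    covNum norm2 (Flin d1 d2 BW) ε x ≤ 1 := by
  rcases mul_eq_zero.1 h with rfl | rfl
  · have hτ : 0 < 3 * BW + 1 := by positivity
    have hfl : ⌊3 * BW / (3 * BW + 1)⌋₊ = 0 := by
      rw [Nat.floor_eq_zero, div_lt_one hτ]
      linarith
    have hB : 0 < ε / (2 * (3 * BW + 1)) := by positivity
    have := covNum_Flin_le_pow (d1 := d1) (BW := BW) hτ hB hε.le ?_ x fun i => (hx i).trans hB.le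
    · simpa [hfl] using this
    · have : 4 * (3 * BW + 1) * (ε / (2 * (3 * BW + 1))) ^ 2 * BW
          = ε ^ 2 * (BW / (3 * BW + 1)) := by field_simp; ring
      rw [this]
      refine mul_le_of_le_one_right (by positivity) ((div_le_one hτ).2 (by linarith))
  · simpa using covNum_Flin_le_pow (d1 := d1) (BW := 0) one_pos (by positivity : 0 < BX + 1) hε.le
      (by simpa using sq_nonneg ε) x fun i => (hx i).trans (by linarith)

theorem ne_top_and_log_toNat_le {a : ℕ∞} {m : ℕ} (h : a ≤ m) :
    a ≠ ⊤ ∧ Real.log (a.toNat : ℝ) ≤ Real.log m := by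
  have htop : a ≠ ⊤ := ne_top_of_le_ne_top (ENat.natCast_ne_top m) h
  lift a to ℕ using htop
  refine ⟨ENat.natCast_ne_top a, ?_⟩
  rw [ENat.toNat_natCast]
  rcases Nat.eq_zero_or_pos a with rfl | ha
  · simpa using Real.log_natCast_nonneg m
  · exact Real.log_le_log (by exact_mod_cast ha) (by exact_mod_cast h)

theorem log_two_mul_succ_add_one_le {d1 N : ℕ} (hd : 0 < d1) (hN : 0 < N) {R : ℝ} (hR : 0 ≤ R) :
    Real.log ((2 * (d1 * (N + 1)) + 1 : ℕ) : ℝ) ≤ 3 * Real.log ((2 + R) * d1 * N) := by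
  have hd' : (1 : ℝ) ≤ d1 := by exact_mod_cast hd
  have hN' : (1 : ℝ) ≤ N := by exact_mod_cast hN
  have hm : (1 : ℝ) ≤ d1 * N := one_le_mul_of_one_le_of_one_le hd' hN'
  have h2 : 2 * ((d1 : ℝ) * N) ≤ (2 + R) * d1 * N := by nlinarith
  have h3 : 3 * Real.log ((2 + R) * d1 * N) = Real.log (((2 + R) * d1 * N) ^ 3) := by
    rw [Real.log_pow, Nat.cast_ofNat]
  rw [h3]
  refine Real.log_le_log (by positivity) ?_
  calc ((2 * (d1 * (N + 1)) + 1 : ℕ) : ℝ) ≤ 5 * ((d1 : ℝ) * N) := by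
        push_cast
        nlinarith
    _ ≤ (2 * ((d1 : ℝ) * N)) ^ 3 := by
        nlinarith [mul_le_mul hm hm zero_le_one (by positivity),
          mul_le_mul_of_nonneg_left hm (by positivity : (0 : ℝ) ≤ (d1 * N) * (d1 * N))]
    _ ≤ ((2 + R) * d1 * N) ^ 3 := by gcongr

/-- ∞-norm covering number bound for the vector-valued linear function class,
with an absolute constant `c`. -/
theorem linear_class_covering :
    ∃ c : ℝ, 0 < c ∧
      ∀ (d1 d2 N : ℕ) (BW BX ε : ℝ), 0 ≤ BW → 0 ≤ BX → 0 < ε →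
        ∀ x : Fin N → (Fin d2 → ℝ), (∀ i, norm2 (x i) ≤ BX) →
          covNum norm2 (Flin d1 d2 BW) ε x ≠ ⊤ ∧
          Real.log ((covNum norm2 (Flin d1 d2 BW) ε x).toNat : ℝ) ≤
            c * (BX * BW) ^ 2 / ε ^ 2 * Real.log ((2 + BX * BW / ε) * d1 * N) := by
  refine ⟨36, by norm_num, fun d1 d2 N BW BX ε hBW hBX hε x hx => ?_⟩
  by_cases hdeg : (d1 = 0 ∨ N = 0) ∨ BX * BW = 0
  · have hle : covNum norm2 (Flin d1 d2 BW) ε x ≤ (1 : ℕ) := by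
      rw [Nat.cast_one]
      exact hdeg.elim (fun h => covNum_Flin_le_one_of_subsingleton hε.le h x)
        fun h => covNum_Flin_le_one_of_mul_eq_zero hBW hBX hε h x hx
    refine (ne_top_and_log_toNat_le hle).imp_right fun h => h.trans ?_
    rw [Nat.cast_one, Real.log_one]
    rcases hdeg with (rfl | rfl) | h
    · simp
    · simp
    · simp [h]
  · push Not at hdeg
    obtain ⟨⟨hd, hN⟩, hne⟩ := hdeg
    have hX : 0 < BX := hBX.lt_of_ne' (left_ne_zero_of_mul hne)
    have hW : 0 < BW := hBW.lt_of_ne' (right_ne_zero_of_mul hne)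
    have hR : 0 ≤ BX * BW / ε := by positivity
    have hlog := log_two_mul_succ_add_one_le (Nat.pos_of_ne_zero hd) (Nat.pos_of_ne_zero hN) hR
    have hτ : 0 < ε ^ 2 / (4 * BX ^ 2 * BW) := by positivity
    refine (ne_top_and_log_toNat_le
      (covNum_Flin_le_pow hτ hX hε.le (le_of_eq ?_) x hx)).imp_right fun h => h.trans ?_
    · field_simp
    · rw [Nat.cast_pow, Real.log_pow]
      calc _ ≤ 3 * BW / (ε ^ 2 / (4 * BX ^ 2 * BW))
            * (3 * Real.log ((2 + BX * BW / ε) * d1 * N)) :=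
            mul_le_mul (Nat.floor_le (by positivity)) hlog (Real.log_natCast_nonneg _)
              (by positivity)
        _ = _ := by field_simp; ring
end
end

section
/- Fix T, s, d, k with s ≤ min(d, k), and pairwise orthogonal unit vectors v₁, e₀, e₁, v_CLS ∈ ℝ^d. Let I ⊆ [T] with |I| = s. For every 0 < γ ≤ 1 there exist a positional embedding matrix P ∈ ℝ^{T×d} with ‖P^⊤‖_{2,1} ≤ s and Transformer weights W_Q, W_K, W_V ∈ ℝ^{d×k}, W_C ∈ ℝ^{k×d} with ‖W_Q‖_F ≤ log(8T/γ), ‖W_K‖_F ≤ 1, ‖W_V‖_F ≤ 2, ‖W_C‖_F ≤ 1, such that for every b ∈ {0,1}^T: |softmax(v_CLS^⊤ W_Q W_K^⊤ X̃(b)^⊤)·X̃(b)·W_V W_C e₁^(d) − (1/s)·Σ_{i∈I}(1 − 2b_i)| ≤ γ/4, where e₁^(d) is the first standard basis vector of ℝ^d. -/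
open Matrix
open scoped BigOperators

noncomputable section

/-- Frobenius norm of a matrix. -/
def frobNorm {a b : ℕ} (M : Matrix (Fin a) (Fin b) ℝ) : ℝ :=
  Real.sqrt (∑ i, ∑ j, (M i j) ^ 2)

/-- The softmax map on ℝ^(T+1). -/
def softmax {T : ℕ} (z : Fin T → ℝ) : Fin T → ℝ :=
  fun t => Real.exp (z t) / ∑ u, Real.exp (z u)

/-- The input `X̃(b) ∈ ℝ^{(T+1)×d}`: row `t < T` is the token embedding `e_{b_t}` plus the
positional embedding `P_t`, and the last row is the `[CLS]` vector. -/
def Xtil {T d : ℕ} (P : Matrix (Fin T) (Fin d) ℝ) (e0 e1 vCLS : Fin d → ℝ)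
    (b : Fin T → Bool) : Matrix (Fin (T + 1)) (Fin d) ℝ :=
  Fin.snoc (fun t => (if b t then e1 else e0) + P t) vCLS

/-- The scalar output of the self-attention head at the `[CLS]` query:
`softmax(v_CLS^⊤ W_Q W_K^⊤ X^⊤) · X · W_V W_C e_j₀`. -/
noncomputable def clsOut {T d k : ℕ} (vCLS : Fin d → ℝ)
    (WQ WK WV : Matrix (Fin d) (Fin k) ℝ) (WC : Matrix (Fin k) (Fin d) ℝ)
    (X : Matrix (Fin (T + 1)) (Fin d) ℝ) (j0 : Fin d) : ℝ :=
  ∑ t, softmax (fun u => vCLS ⬝ᵥ ((WQ * WKᵀ) *ᵥ X u)) t * (X * WV * WC) t j0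

lemma norm2_single {n : ℕ} (i : Fin n) : norm2 (Pi.single i (1 : ℝ)) = 1 := by
  simp [norm2, Pi.single_apply]

lemma norm2_smul {n : ℕ} (c : ℝ) (v : Fin n → ℝ) : norm2 (c • v) = |c| * norm2 v := by
  simp only [norm2, Pi.smul_apply, smul_eq_mul, mul_pow]
  rw [← Finset.mul_sum, Real.sqrt_mul (sq_nonneg c), Real.sqrt_sq_eq_abs]

lemma norm2_sq {n : ℕ} (v : Fin n → ℝ) : norm2 v ^ 2 = v ⬝ᵥ v := by
  rw [norm2, Real.sq_sqrt (Finset.sum_nonneg fun _ _ => sq_nonneg _)]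
  simp [dotProduct, sq]

lemma frobNorm_vecMulVec {m n : ℕ} (u : Fin m → ℝ) (v : Fin n → ℝ) :
    frobNorm (vecMulVec u v) = norm2 u * norm2 v := by
  rw [frobNorm, norm2, norm2, ← Real.sqrt_mul (Finset.sum_nonneg fun _ _ => sq_nonneg _),
    Finset.sum_mul_sum]
  simp only [vecMulVec_apply, mul_pow]

/-- With rank-one weights sharing a unit inner direction, attention scores are proportional to
the inner product with the key direction and values are inner products with the value direction. -/
lemma clsOut_vecMulVec {T d k : ℕ} (q κ v w : Fin d → ℝ) (c : Fin k → ℝ) (hc : c ⬝ᵥ c = 1)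
    (X : Matrix (Fin (T + 1)) (Fin d) ℝ) (j : Fin d) :
    clsOut v (vecMulVec q c) (vecMulVec κ c) (vecMulVec w c) (vecMulVec c (Pi.single j 1)) X j =
      ∑ t, softmax (fun u => (v ⬝ᵥ q) * (κ ⬝ᵥ X u)) t * (X t ⬝ᵥ w) := by
  have hscore (x : Fin d → ℝ) :
      v ⬝ᵥ ((vecMulVec q c * (vecMulVec κ c)ᵀ) *ᵥ x) = (v ⬝ᵥ q) * (κ ⬝ᵥ x) := by
    rw [transpose_vecMulVec, vecMulVec_mul_vecMulVec, hc, one_smul, vecMulVec_mulVec]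
    simp [mul_comm]
  have hvalue (t : Fin (T + 1)) :
      (X * vecMulVec w c * vecMulVec c (Pi.single j 1)) t j = X t ⬝ᵥ w := by
    rw [Matrix.mul_assoc, vecMulVec_mul_vecMulVec, hc, one_smul, mul_vecMulVec]
    simp [vecMulVec_apply, mulVec]
  simp only [clsOut, hscore, hvalue]

/-- Averaging with weight `E` on `I`, weight `1` off `I`, and an extra zero entry of weight `1`
deviates from the plain average over `I` by at most `2 |ι| / E`. -/
lemma abs_weighted_average_sub_le {ι : Type*} [Fintype ι] [DecidableEq ι] (I : Finset ι)
    (hI : I.Nonempty) (y : ι → ℝ) (hy : ∀ i, |y i| ≤ 1) {E : ℝ} (hE : 0 < E) :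
    |(∑ i, (if i ∈ I then E else 1) * y i) / (∑ i, (if i ∈ I then E else 1) + 1) -
      1 / (I.card : ℝ) * ∑ i ∈ I, y i| ≤ 2 * Fintype.card ι / E := by
  have hsplit (f : ι → ℝ) : ∑ i, (if i ∈ I then E else 1) * f i =
      E * ∑ i ∈ I, f i + ∑ i ∈ Iᶜ, f i := by
    rw [← Finset.sum_add_sum_compl I, Finset.mul_sum]
    congr 1
    · exact Finset.sum_congr rfl fun i hi => by simp [hi]
    · exact Finset.sum_congr rfl fun i hi => by simp [Finset.mem_compl.1 hi]
  have hbound (J : Finset ι) : |∑ i ∈ J, y i| ≤ J.card := by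
    refine (Finset.abs_sum_le_sum_abs _ _).trans ?_
    simpa using Finset.sum_le_sum fun i (_ : i ∈ J) => hy i
  have hden := hsplit 1
  simp only [Pi.one_apply, mul_one, Finset.sum_const, nsmul_eq_mul] at hden
  rw [hsplit, hden]
  have hcard : (I.card : ℝ) + (Iᶜ.card : ℝ) = Fintype.card ι := by
    exact_mod_cast Finset.card_add_card_compl I
  have hs : (1 : ℝ) ≤ I.card := by exact_mod_cast hI.card_pos
  have hA := hbound I
  have hB := hbound Iᶜ
  generalize ∑ i ∈ I, y i = A at *
  generalize ∑ i ∈ Iᶜ, y i = B at *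
  have hm : (0 : ℝ) ≤ Iᶜ.card := Nat.cast_nonneg _
  generalize (I.card : ℝ) = s at *
  generalize (Iᶜ.card : ℝ) = m at *
  rw [← hcard]
  have hs0 : 0 < s := by linarith
  have hZ : E ≤ E * s + m + 1 := by nlinarith
  have hZ0 : 0 < E * s + m + 1 := hE.trans_le hZ
  have heq : (E * A + B) / (E * s + m + 1) - 1 / s * A =
      (B - A / s * (m + 1)) / (E * s + m + 1) := by
    field_simp
    ring
  have hAs : |A / s| ≤ 1 := by
    rw [abs_div, abs_of_pos hs0]
    exact (div_le_one hs0).2 hA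
  rw [heq, abs_div, abs_of_pos hZ0]
  refine div_le_div₀ (by linarith) ?_ hE hZ
  calc |B - A / s * (m + 1)| ≤ |B| + |A / s| * (m + 1) := by
        refine (abs_sub _ _).trans_eq ?_
        rw [abs_mul, abs_of_pos (by linarith : 0 < m + 1)]
    _ ≤ 2 * (s + m) := by nlinarith

/-- trainable positional embeddings, single head: there exist a positional
embedding `P` with `‖Pᵀ‖_{2,1} ≤ s` and Transformer weights with the stated Frobenius-norm
bounds such that the scalar self-attention output `γ/4`-uniformly approximates the
monotone symmetric `I`-sparse function `(1/s)·∑_{i∈I}(1 − 2 b_i)`. -/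
theorem sparse_representation_trainable_pos
    (T s d k : ℕ) (hs : 0 < s) (hsd : s ≤ d) (hsk : s ≤ k)
    (v1 e0 e1 vCLS : Fin d → ℝ)
    (hv1 : norm2 v1 = 1) (he0 : norm2 e0 = 1) (he1 : norm2 e1 = 1) (hcls : norm2 vCLS = 1)
    (hv1e0 : v1 ⬝ᵥ e0 = 0) (hv1e1 : v1 ⬝ᵥ e1 = 0) (hv1cls : v1 ⬝ᵥ vCLS = 0)
    (he0e1 : e0 ⬝ᵥ e1 = 0) (he0cls : e0 ⬝ᵥ vCLS = 0) (he1cls : e1 ⬝ᵥ vCLS = 0)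
    (I : Finset (Fin T)) (hI : I.card = s)
    (γ : ℝ) (hγ0 : 0 < γ) (hγ1 : γ ≤ 1) :
    ∃ (P : Matrix (Fin T) (Fin d) ℝ)
      (WQ WK WV : Matrix (Fin d) (Fin k) ℝ) (WC : Matrix (Fin k) (Fin d) ℝ),
      (∑ t, norm2 (P t)) ≤ (s : ℝ) ∧
      frobNorm WQ ≤ Real.log (8 * T / γ) ∧ frobNorm WK ≤ 1 ∧
      frobNorm WV ≤ 2 ∧ frobNorm WC ≤ 1 ∧
      ∀ b : Fin T → Bool,
        |clsOut vCLS WQ WK WV WC (Xtil P e0 e1 vCLS b) ⟨0, lt_of_lt_of_le hs hsd⟩ -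
            (1 / (s : ℝ)) * ∑ i ∈ I, (1 - 2 * (if b i then (1 : ℝ) else 0))| ≤ γ / 4 := by
  have hk : 0 < k := hs.trans_le hsk
  have hIne : I.Nonempty := Finset.card_pos.1 (hI ▸ hs)
  have hT : (1 : ℝ) ≤ T := by
    have : I.card ≤ T := by simpa using I.card_le_univ
    exact_mod_cast hs.trans_le (hI ▸ this)
  have hE : 1 ≤ 8 * T / γ := by
    rw [one_le_div hγ0]
    linarith
  have hE0 : 0 < 8 * T / γ := one_pos.trans_le hE
  have hself {v : Fin d → ℝ} (hv : norm2 v = 1) : v ⬝ᵥ v = 1 := by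
    rw [← norm2_sq, hv, one_pow]
  set c : Fin k → ℝ := Pi.single ⟨0, hk⟩ 1
  have hc : norm2 c = 1 := norm2_single _
  have hcc : c ⬝ᵥ c = 1 := by rw [← norm2_sq, hc, one_pow]
  set L := Real.log (8 * T / γ)
  have hL : Real.exp L = 8 * T / γ := Real.exp_log hE0
  refine ⟨fun t => if t ∈ I then v1 else 0, vecMulVec (L • vCLS) c, vecMulVec v1 c,
    vecMulVec (e0 - e1) c, vecMulVec c (Pi.single ⟨0, hs.trans_le hsd⟩ 1), ?_, ?_, ?_, ?_, ?_, ?_⟩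
  · have hnorm (t : Fin T) : norm2 (if t ∈ I then v1 else 0) = if t ∈ I then 1 else 0 := by
      split_ifs
      · exact hv1
      · simp [norm2]
    simp [hnorm, hI]
  · rw [frobNorm_vecMulVec, norm2_smul, hcls, hc, abs_of_nonneg (Real.log_nonneg hE)]
    rw [mul_one, mul_one]
  · simp [frobNorm_vecMulVec, hv1, hc]
  · rw [frobNorm_vecMulVec, hc, mul_one]
    refine le_of_sq_le_sq ?_ zero_le_two
    rw [norm2_sq, sub_dotProduct, dotProduct_sub, dotProduct_sub, hself he0, hself he1, he0e1,
      dotProduct_comm e1, he0e1]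
    norm_num
  · simp [frobNorm_vecMulVec, norm2_single, hc]
  · intro b
    rw [clsOut_vecMulVec _ _ _ _ _ hcc]
    have hscore (t : Fin T) : Real.exp (L * (v1 ⬝ᵥ ((if b t then e1 else e0) +
        if t ∈ I then v1 else 0))) = if t ∈ I then 8 * T / γ else 1 := by
      split_ifs <;> simp [dotProduct_add, hv1e0, hv1e1, hself hv1, hL]
    have hvalue (t : Fin T) : ((if b t then e1 else e0) + if t ∈ I then v1 else 0) ⬝ᵥ (e0 - e1) =
        1 - 2 * (if b t then (1 : ℝ) else 0) := by
      have he1e0 : e1 ⬝ᵥ e0 = 0 := by rw [dotProduct_comm, he0e1]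
      split_ifs <;>
        simp [add_dotProduct, dotProduct_sub, hv1e0, hv1e1, hself he0, hself he1, he0e1, he1e0] <;>
        norm_num
    have hclsval : vCLS ⬝ᵥ (e0 - e1) = 0 := by
      rw [dotProduct_comm, sub_dotProduct, he0cls, he1cls, sub_zero]
    have hy (t : Fin T) : |1 - 2 * (if b t then (1 : ℝ) else 0)| ≤ 1 := by
      split_ifs <;> norm_num
    have key := abs_weighted_average_sub_le I hIne _ hy hE0
    have hrate : 2 * (Fintype.card (Fin T) : ℝ) / (8 * T / γ) = γ / 4 := by
      rw [Fintype.card_fin]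
      field_simp
      norm_num
    rw [hI, hrate] at key
    convert key using 3
    simp only [softmax, Xtil, Fin.sum_univ_castSucc, Fin.snoc_castSucc, Fin.snoc_last,
      dotProduct_smul, hself hcls, smul_eq_mul, mul_one, hscore, hvalue, hclsval, hv1cls, mul_zero,
      Real.exp_zero, add_zero, Finset.sum_div, div_mul_eq_mul_div, zero_div]
end
end
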